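/- Let p ≥ 3 be prime, let k be a positive integer with p ∤ k, let φ(x) = x^p + kp·x^{p−1} − kp ∈ ℤ[x], and let a = −k(p−1). Suppose the forward orbit of a under φ is infinite (i.e. the values φ^n(a), n ≥ 1, are pairwise distinct). Then there exists N such that for all n ≥ N the extension K_n/K_{n−1} is maximal, i.e. Gal(K_n/K_{n−1}) has order (p!)^{p^{n−1}}. (Consequently the image of the arboreal Galois representation of φ over ℚ has finite index in Aut(T_∞).) -/

import Mathlib

open Polynomial

noncomputable section

/-- The `n`-th iterate of a polynomial under composition: `polyIter φ 0 = X`,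
`polyIter φ (n+1) = φ ∘ (polyIter φ n)`. -/
def polyIter {R : Type*} [CommRing R] (φ : Polynomial R) : ℕ → Polynomial R
  | 0 => X
  | n + 1 => φ.comp (polyIter φ n)

/-- The splitting field `K_n` of the `n`-th iterate of `φ ∈ ℤ[x]` over `ℚ`, inside a fixed
algebraic closure of `ℚ`. -/
def Kfield (φ : Polynomial ℤ) (n : ℕ) : IntermediateField ℚ (AlgebraicClosure ℚ) :=
  IntermediateField.adjoin ℚ ((polyIter φ n).rootSet (AlgebraicClosure ℚ))

/-- The order of `Gal(K_n / K_{n-1})`: the number of automorphisms of `K_n` over `ℚ`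
fixing every element of `K_{n-1}` pointwise. -/
def relGalCard (φ : Polynomial ℤ) (n : ℕ) : ℕ :=
  Nat.card {σ : Kfield φ n ≃ₐ[ℚ] Kfield φ n //
    ∀ (x : AlgebraicClosure ℚ) (_ : x ∈ Kfield φ (n - 1)) (hx' : x ∈ Kfield φ n),
      σ ⟨x, hx'⟩ = ⟨x, hx'⟩}

end

section Iterates

variable {φ : ℤ[X]}

theorem polyIter_add (φ : ℤ[X]) (m n : ℕ) :
    polyIter φ (m + n) = (polyIter φ m).comp (polyIter φ n) := by
  induction m with
  | zero => simp [polyIter]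
  | succ m ih => rw [Nat.succ_add, polyIter, ih, polyIter, comp_assoc]

theorem aeval_polyIter_add {D : Type*} [CommRing D] (φ : ℤ[X]) (m n : ℕ) (x : D) :
    aeval x (polyIter φ (m + n)) = aeval (aeval x (polyIter φ n)) (polyIter φ m) := by
  rw [polyIter_add, aeval_comp]

theorem polyIter_one (φ : ℤ[X]) : polyIter φ 1 = φ := by simp [polyIter]

theorem aeval_polyIter_succ {D : Type*} [CommRing D] (φ : ℤ[X]) (n : ℕ) (x : D) :
    aeval x (polyIter φ (n + 1)) = aeval (aeval x (polyIter φ n)) φ := by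
  rw [polyIter, aeval_comp]

theorem aeval_polyIter_succ' {D : Type*} [CommRing D] (φ : ℤ[X]) (n : ℕ) (x : D) :
    aeval x (polyIter φ (n + 1)) = aeval (aeval x φ) (polyIter φ n) := by
  rw [aeval_polyIter_add, polyIter_one]

theorem polyIter_monic (hφ : φ.Monic) (hd : φ.natDegree ≠ 0) (n : ℕ) :
    (polyIter φ n).Monic ∧ (polyIter φ n).natDegree = φ.natDegree ^ n := by
  induction n with
  | zero => simp [polyIter, monic_X]
  | succ n ih =>
    refine ⟨hφ.comp ih.1 (by rw [ih.2]; positivity), ?_⟩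
    rw [polyIter, natDegree_comp, ih.2, pow_succ']

/-- A critical point of an iterate is sent to a critical point of `φ` by a smaller iterate. -/
theorem exists_critical_of_aeval_derivative_polyIter {D : Type*} [CommRing D] [IsDomain D]
    (n : ℕ) (x : D) (hx : aeval x (derivative (polyIter φ n)) = 0) :
    ∃ i < n, aeval (aeval x (polyIter φ i)) (derivative φ) = 0 := by
  induction n with
  | zero => simp [polyIter] at hx
  | succ n ih =>
    rw [polyIter, derivative_comp, map_mul, aeval_comp, mul_eq_zero] at hx
    rcases hx with hx | hx
    · obtain ⟨i, hi, h⟩ := ih hx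
      exact ⟨i, hi.trans n.lt_succ_self, h⟩
    · exact ⟨n, n.lt_succ_self, hx⟩

end Iterates

section Family

variable {p k : ℕ}

/-- The polynomial `x ^ p + k p x ^ (p - 1) - k p`. -/
noncomputable def phi (p k : ℕ) : ℤ[X] :=
  X ^ p + C ((k : ℤ) * p) * X ^ (p - 1) - C ((k : ℤ) * p)

theorem aeval_phi {D : Type*} [CommRing D] (x : D) :
    aeval x (phi p k) = x ^ p + (k * p) * x ^ (p - 1) - k * p := by
  simp [phi]

theorem phi_monic_natDegree (hp : 1 < p) : (phi p k).Monic ∧ (phi p k).natDegree = p := by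
  have h : phi p k = X ^ p + (C ((k : ℤ) * p) * X ^ (p - 1) - C ((k : ℤ) * p)) := by
    rw [phi]; ring
  have hd : (C ((k : ℤ) * p) * X ^ (p - 1) - C ((k : ℤ) * p)).degree < (p : WithBot ℕ) := by
    refine (degree_sub_le _ _).trans_lt (max_lt ?_ ?_)
    · refine (degree_C_mul_X_pow_le _ _).trans_lt ?_
      exact_mod_cast Nat.sub_lt (by omega) one_pos
    · exact degree_C_le.trans_lt (by exact_mod_cast (by omega : 0 < p))
  rw [h]
  refine ⟨monic_X_pow_add hd, ?_⟩
  rw [natDegree_add_eq_left_of_degree_lt (by rwa [degree_X_pow]), natDegree_X_pow]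

theorem aeval_derivative_phi {D : Type*} [CommRing D] (hp : 3 ≤ p) (x : D) :
    aeval x (derivative (phi p k)) = p * x ^ (p - 2) * (x + k * (p - 1)) := by
  obtain ⟨m, rfl⟩ : ∃ m, p = m + 3 := ⟨p - 3, by omega⟩
  simp [phi, map_ofNat]
  ring

theorem aeval_zero_polyIter_phi {D : Type*} [CommRing D] (hp : 3 ≤ p) (n : ℕ) :
    aeval (0 : D) (polyIter (phi p k) (n + 1)) = -(k * p) := by
  obtain ⟨m, rfl⟩ : ∃ m, p = m + 3 := ⟨p - 3, by omega⟩
  induction n with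
  | zero => simp [polyIter_one, aeval_phi]
  | succ n ih =>
    rw [aeval_polyIter_succ, ih, aeval_phi]
    push_cast
    ring


/-- The free critical point of `phi p k`. -/
def critPt (p k : ℕ) : ℤ := -(k : ℤ) * ((p : ℤ) - 1)

theorem exists_aeval_critPt_polyIter_phi (hp : 3 ≤ p) (hodd : Odd p) (n : ℕ) :
    ∃ s : ℤ, aeval (critPt p k) (polyIter (phi p k) n) = k * (s ^ 2 - p) := by
  obtain ⟨m, rfl⟩ := hodd
  induction n with
  | zero => exact ⟨1, by simp [polyIter, critPt]⟩
  | succ n ih =>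
    obtain ⟨s, hs⟩ := ih
    refine ⟨(k * (s ^ 2 - (2 * m + 1 : ℕ))) ^ m * s, ?_⟩
    rw [aeval_polyIter_succ, hs, aeval_phi]
    push_cast
    ring

theorem not_dvd_aeval_critPt (hp : p.Prime) (hpk : ¬ p ∣ k) (n : ℕ) :
    ¬ (p : ℤ) ∣ aeval (critPt p k) (polyIter (phi p k) n) := by
  have hp' := Nat.prime_iff_prime_int.1 hp
  induction n with
  | zero =>
    intro h
    apply hpk
    have : (p : ℤ) ∣ k := by
      have := dvd_add h (dvd_mul_left (p : ℤ) k)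
      simpa [polyIter, critPt, mul_sub] using this
    exact_mod_cast this
  | succ n ih =>
    intro h
    rw [aeval_polyIter_succ, aeval_phi] at h
    apply ih
    refine hp'.dvd_of_dvd_pow (n := p) ?_
    have h2 : ∀ y : ℤ, (p : ℤ) ∣ y ^ p + k * p * y ^ (p - 1) - k * p → (p : ℤ) ∣ y ^ p := by
      rintro y ⟨c, hc⟩
      exact ⟨c - k * y ^ (p - 1) + k, by linear_combination hc⟩
    exact h2 _ h

theorem exists_prime_odd_multiplicity {w : ℤ} (hw : ∀ y : ℤ, w ≠ y ^ 2 ∧ w ≠ -y ^ 2) :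
    ∃ q m : ℕ, ∃ u : ℤ, q.Prime ∧ Odd m ∧ w = q ^ m * u ∧ ¬ (q : ℤ) ∣ u := by
  obtain ⟨c, b, -, -, h, hc⟩ := Nat.sq_mul_squarefree_of_pos
    (Int.natAbs_pos.2 (show w ≠ 0 by simpa using (hw 0).1))
  have hc1 : c ≠ 1 := by
    rintro rfl
    rcases Int.natAbs_eq w with h' | h'
    · exact (hw b).1 (by rw [h', ← h]; push_cast; ring)
    · exact (hw b).2 (by rw [h', ← h]; push_cast; ring)
  have hb : b ≠ 0 := by
    rintro rfl
    exact (hw 0).1 (by simpa using h.symm)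
  obtain ⟨q, hq, d, rfl⟩ := Nat.exists_prime_and_dvd hc1
  have hqd : ¬ q ∣ d := fun ⟨e, he⟩ =>
    hq.one_lt.ne' (Nat.isUnit_iff.1 (hc q ⟨e, by rw [he]; ring⟩))
  obtain ⟨e, b', hb', rfl⟩ := Nat.exists_eq_pow_mul_and_not_dvd hb q hq.ne_one
  have hqu : ¬ (q : ℤ) ∣ (b' ^ 2 * d : ℕ) := by
    rw [Int.natCast_dvd_natCast, hq.dvd_mul, not_or]
    exact ⟨fun h => hb' (hq.dvd_of_dvd_pow h), hqd⟩
  rcases Int.natAbs_eq w with h' | h'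
  · exact ⟨q, 2 * e + 1, _, hq, odd_two_mul_add_one e,
      by rw [h', ← h]; push_cast; ring, hqu⟩
  · exact ⟨q, 2 * e + 1, -(b' ^ 2 * d : ℕ), hq, odd_two_mul_add_one e,
      by rw [h', ← h]; push_cast; ring, by rwa [dvd_neg]⟩

theorem abs_le_of_sq_sub_eq {p : ℕ} (hp : 0 < p) {s y : ℤ}
    (h : s ^ 2 - p = y ^ 2 ∨ s ^ 2 - p = -y ^ 2) : |s| ≤ p := by
  rw [← sq_abs s, ← sq_abs y] at h
  have hp' : (0 : ℤ) < p := by exact_mod_cast hp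
  have hs := abs_nonneg s
  have hy := abs_nonneg y
  generalize |s| = s at *
  generalize |y| = y at *
  rcases h with h | h
  · rcases lt_or_ge y s with h1 | h1
    · nlinarith
    · nlinarith
  · nlinarith

theorem exists_good_prime (hp : p.Prime) (hp3 : 3 ≤ p) (hk : 0 < k) (hpk : ¬ p ∣ k)
    (horbit : ∀ m n : ℕ, 1 ≤ m → 1 ≤ n → aeval (critPt p k) (polyIter (phi p k) m) =
      aeval (critPt p k) (polyIter (phi p k) n) → m = n) :
    ∃ N : ℕ, ∀ n, N ≤ n → ∃ q m : ℕ, ∃ u : ℤ, q.Prime ∧ ¬ q ∣ k * p ∧ Odd m ∧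
      aeval (critPt p k) (polyIter (phi p k) (n + 1)) = q ^ m * u ∧ ¬ (q : ℤ) ∣ u := by
  have hodd : Odd p := hp.odd_of_ne_two (by omega)
  set x : ℕ → ℤ := fun n => aeval (critPt p k) (polyIter (phi p k) n) with hx
  have hfin : {n : ℕ | |x (n + 1)| ≤ k * p ^ 2 + k * p}.Finite := by
    refine Set.Finite.of_finite_image (f := fun n => x (n + 1))
      ((Set.finite_Icc (-(k * p ^ 2 + k * p) : ℤ) (k * p ^ 2 + k * p)).subset ?_) ?_
    · rintro _ ⟨n, hn, rfl⟩
      exact abs_le.1 hn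
    · intro m _ n _ h
      have := horbit (m + 1) (n + 1) (by omega) (by omega) h
      omega
  obtain ⟨M, hM⟩ := hfin.bddAbove
  refine ⟨M + 1, fun n hn => ?_⟩
  obtain ⟨s, hs⟩ := exists_aeval_critPt_polyIter_phi (k := k) hp3 hodd (n + 1)
  have hw : ∀ y : ℤ, s ^ 2 - p ≠ y ^ 2 ∧ s ^ 2 - p ≠ -y ^ 2 := by
    intro y
    rw [← not_or]
    intro h
    have h1 := abs_le_of_sq_sub_eq hp.pos h
    have : n ∈ {n : ℕ | |x (n + 1)| ≤ k * p ^ 2 + k * p} := by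
      change |x (n + 1)| ≤ _
      simp only [hx]
      rw [hs, abs_mul, Nat.abs_cast]
      have h2 : |s ^ 2 - (p : ℤ)| ≤ p ^ 2 + p := by
        rw [abs_le]
        have h3 := sq_le_sq' (neg_le_of_abs_le h1) (le_of_abs_le h1)
        constructor <;> nlinarith [sq_nonneg s]
      nlinarith
    have := hM this
    omega
  obtain ⟨q, m, u, hq, hm, hwu, hqu⟩ := exists_prime_odd_multiplicity hw
  have hq' := Nat.prime_iff_prime_int.1 hq
  have hqw : (q : ℤ) ∣ s ^ 2 - p := by
    rw [hwu]
    exact (dvd_pow_self _ hm.pos.ne').mul_right _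
  have hqp : q ≠ p := by
    rintro rfl
    exact not_dvd_aeval_critPt hp hpk (n + 1) (hs ▸ hqw.mul_left _)
  have hqk : ¬ q ∣ k := by
    intro h
    have h' : (q : ℤ) ∣ k := by exact_mod_cast h
    obtain ⟨t, ht⟩ := exists_aeval_critPt_polyIter_phi (k := k) hp3 hodd n
    rw [aeval_polyIter_succ, ht, aeval_phi, ← pow_sub_one_mul hp.ne_zero] at hs
    have hk0 : (k : ℤ) ≠ 0 := by exact_mod_cast hk.ne'
    generalize hy : (k * (t ^ 2 - p) : ℤ) ^ (p - 1) = y at hs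
    have hqy : (q : ℤ) ∣ y := by
      rw [← hy]
      exact (h'.mul_right _).trans (dvd_pow_self _ (Nat.sub_ne_zero_of_lt hp.one_lt))
    have h1 : (p : ℤ) = y * t ^ 2 - (s ^ 2 - p) :=
      mul_left_cancel₀ hk0 (by linear_combination -hs)
    have h2 : (q : ℤ) ∣ p := h1 ▸ (hqy.mul_right _).sub hqw
    exact hqp ((Nat.prime_dvd_prime_iff_eq hq hp).1 (by exact_mod_cast h2))
  refine ⟨q, m, k * u, hq, ?_, hm, by rw [hs, hwu]; ring, ?_⟩
  · rw [hq.dvd_mul, not_or]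
    exact ⟨hqk, fun h => hqp ((Nat.prime_dvd_prime_iff_eq hq hp).1 h)⟩
  · rw [hq'.dvd_mul, not_or]
    exact ⟨by exact_mod_cast hqk, hqu⟩

end Family

open Equiv in
/-- If a transitive permutation group permutes the fibres of `π`, all of prime size, and contains
a transposition, then it contains every permutation preserving each fibre. -/
theorem mem_of_swap_mem_of_prime_fiber {α β : Type*} [Finite α] [DecidableEq α]
    (G : Subgroup (Perm α)) (htrans : ∀ x y : α, ∃ g ∈ G, g x = y) (π : α → β)
    (hπ : ∀ g ∈ G, ∀ x y, π x = π y → π (g x) = π (g y)) {p : ℕ} (hp : p.Prime)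
    (hfib : ∀ x, Nat.card {y // π y = π x} = p) {x₀ y₀ : α} (hne : x₀ ≠ y₀)
    (hswap : swap x₀ y₀ ∈ G) (σ : Perm α) (hσ : ∀ x, π (σ x) = π x) : σ ∈ G := by
  have hself (x : α) : swap x x ∈ G := by
    rw [swap_self]
    exact G.one_mem
  have hconj {g : Perm α} (hg : g ∈ G) {x y : α} (h : swap x y ∈ G) :
      swap (g x) (g y) ∈ G := by
    rw [swap_apply_apply]
    exact G.mul_mem (G.mul_mem hg h) (G.inv_mem hg)
  have htr {x y z : α} (h₁ : swap x y ∈ G) (h₂ : swap y z ∈ G) : swap x z ∈ G := by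
    by_cases hxz : x = z
    · subst hxz; exact hself x
    by_cases hxy : x = y
    · subst hxy; exact h₂
    have := hconj h₂ h₁
    rwa [swap_apply_of_ne_of_ne hxy hxz, swap_apply_left] at this
  have hπswap {x y : α} (h : swap x y ∈ G) : π x = π y := by
    by_contra hxy
    have : Nontrivial {z // π z = π x} := by
      rw [← Finite.one_lt_card_iff_nontrivial, hfib]
      exact hp.one_lt
    obtain ⟨⟨z, hz⟩, hzx⟩ := exists_ne (⟨x, rfl⟩ : {z // π z = π x})
    have hzx : z ≠ x := fun h => hzx (Subtype.ext h)
    have hzy : z ≠ y := by rintro rfl; exact hxy hz.symm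
    have := hπ _ h _ _ hz
    rw [swap_apply_of_ne_of_ne hzx hzy, swap_apply_left] at this
    exact hxy (hz.symm.trans this)
  let T (x : α) : Set α := {y | swap x y ∈ G}
  have hTsub (x : α) : T x ⊆ {y | π y = π x} := fun y hy => (hπswap hy).symm
  have hTcard (x y : α) : (T x).ncard = (T y).ncard := by
    have key (x y : α) : (T x).ncard ≤ (T y).ncard := by
      obtain ⟨g, hg, rfl⟩ := htrans x y
      rw [← Set.ncard_image_of_injective (T x) g.injective]
      refine Set.ncard_le_ncard ?_ (Set.toFinite _)
      rintro _ ⟨z, hz, rfl⟩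
      exact hconj hg hz
    exact (key x y).antisymm (key y x)
  have hdvd (x : α) : (T x).ncard ∣ p := by
    let s : Setoid {y // π y = π x} :=
      { r := fun y z => swap (y : α) z ∈ G
        iseqv := ⟨fun y => hself y, fun {y z} h => by rwa [swap_comm], htr⟩ }
    have := Fintype.ofFinite α
    have := Fintype.ofFinite (Quotient s)
    have hcls (c : Quotient s) : Nat.card {y // Quotient.mk s y = c} = (T x).ncard := by
      obtain ⟨y, rfl⟩ := Quotient.exists_rep c
      rw [hTcard x y, ← Nat.card_coe_set_eq]
      refine Nat.card_congr
        { toFun := fun z => ⟨z.1, by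
            have h : swap (z.1 : α) y ∈ G := Quotient.exact z.2
            rwa [swap_comm] at h⟩
          invFun := fun z => ⟨⟨z.1, ((hTsub y z.2).trans y.2)⟩, by
            refine Quotient.sound ?_
            have h : swap (y : α) z ∈ G := z.2
            rwa [swap_comm] at h⟩
          left_inv := fun z => rfl
          right_inv := fun z => rfl }
    rw [← hfib x, Nat.card_congr (Equiv.sigmaFiberEquiv (Quotient.mk s)).symm, Nat.card_sigma]
    simp [hcls]
  have hone (x : α) : (T x).ncard ≠ 1 := by
    rw [hTcard x x₀]
    have : 1 < (T x₀).ncard :=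
      (Set.one_lt_ncard (Set.toFinite _)).2 ⟨x₀, hself x₀, y₀, hswap, hne⟩
    exact this.ne'
  have hTeq (x : α) : T x = {y | π y = π x} := by
    refine Set.eq_of_subset_of_ncard_le (hTsub x) ?_ (Set.toFinite _)
    rw [((Nat.dvd_prime hp).1 (hdvd x)).resolve_left (hone x), ← hfib x]
    exact (Nat.card_coe_set_eq _).ge
  let S : Set (Perm α) := {g | g ∈ G ∧ g.IsSwap}
  have hSG : Subgroup.closure S ≤ G := (Subgroup.closure_le G).2 fun g hg => hg.1
  refine hSG ((mem_closure_isSwap (S := S) fun g hg => hg.2).2 ⟨Set.toFinite _, fun x => ?_⟩)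
  by_cases hx : σ x = x
  · rw [hx]; exact MulAction.mem_orbit_self x
  have hmem : swap x (σ x) ∈ S := by
    refine ⟨?_, x, σ x, Ne.symm hx, rfl⟩
    have : σ x ∈ T x := by rw [hTeq]; exact hσ x
    exact this
  exact ⟨⟨_, Subgroup.subset_closure hmem⟩, swap_apply_left _ _⟩

/-- The number of permutations preserving each fibre of a surjection onto `m` points
with all fibres of size `p`. -/
theorem card_fiber_preserving {α β : Type*} [Finite α] [Finite β] (π : α → β) {p m : ℕ}
    (hm : Nat.card β = m) (hfib : ∀ b, Nat.card {y // π y = b} = p) :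
    Nat.card {g : Equiv.Perm α // ∀ x, π (g x) = π x} = p.factorial ^ m := by
  classical
  have := Fintype.ofFinite α
  have := Fintype.ofFinite β
  have h := DomMulAct.stabilizer_card π
  simp only [← Nat.card_eq_fintype_card, hfib, Finset.prod_const, Finset.card_univ, hm] at h
  rw [← h]
  exact Nat.card_congr (Equiv.subtypeEquivRight fun g => funext_iff.symm)

section Reduction

variable {p k : ℕ} {D : Type*} [CommRing D]

theorem aeval_intCast_eq (z : ℤ) (f : ℤ[X]) : aeval (z : D) f = (aeval z f : ℤ) := by
  simpa using aeval_algebraMap_apply D z f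

theorem aeval_derivative_phi_eq_zero [IsDomain D] (hp : 3 ≤ p) (hpD : (p : D) ≠ 0) {x : D}
    (hx : aeval x (derivative (phi p k)) = 0) : x = 0 ∨ x = (critPt p k : D) := by
  rw [aeval_derivative_phi hp, mul_eq_zero, mul_eq_zero] at hx
  rcases hx with (hx | hx) | hx
  · exact absurd hx hpD
  · exact Or.inl (eq_zero_of_pow_eq_zero hx)
  · refine Or.inr ?_
    simp only [critPt]
    push_cast
    linear_combination hx

theorem aeval_critPt_derivative_phi (hp : 3 ≤ p) :
    aeval (critPt p k : D) (derivative (phi p k)) = 0 := by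
  rw [aeval_derivative_phi hp]
  simp [critPt]

theorem aeval_critPt_derivative_derivative_phi (hp : 3 ≤ p) :
    aeval (critPt p k : D) (derivative (derivative (phi p k))) =
      p * (critPt p k : D) ^ (p - 2) := by
  have h : derivative (phi p k) = C (p : ℤ) * X ^ (p - 2) * (X - C (critPt p k)) := by
    obtain ⟨m, rfl⟩ : ∃ m, p = m + 3 := ⟨p - 3, by omega⟩
    simp [phi, critPt]
    ring
  rw [h]
  simp

theorem aeval_critPt_derivative_polyIter (hp : 3 ≤ p) (n : ℕ) :
    aeval (critPt p k : D) (derivative (polyIter (phi p k) (n + 1))) = 0 := by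
  rw [polyIter_add, polyIter_one, derivative_comp, map_mul, aeval_critPt_derivative_phi hp,
    zero_mul]

variable {n : ℕ}

theorem aeval_critPt_polyIter_ne_zero (hp : 3 ≤ p) (hkp : (k * p : D) ≠ 0)
    (h0 : aeval (critPt p k : D) (polyIter (phi p k) (n + 1)) = 0) {m : ℕ} (hm : m ≤ n) :
    aeval (critPt p k : D) (polyIter (phi p k) m) ≠ 0 := by
  intro h
  obtain ⟨j, rfl⟩ := Nat.exists_eq_add_of_le hm
  rw [show m + j + 1 = (j + 1) + m by ring, aeval_polyIter_add, h,
    aeval_zero_polyIter_phi hp] at h0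
  exact hkp (neg_eq_zero.1 h0)

/-- The free critical point is the only multiple root of the reduction. -/
theorem eq_critPt_of_multiple_root [IsDomain D] (hp : 3 ≤ p) (hkp : (k * p : D) ≠ 0)
    (h0 : aeval (critPt p k : D) (polyIter (phi p k) (n + 1)) = 0) {x : D}
    (hx : aeval x (polyIter (phi p k) (n + 1)) = 0)
    (hx' : aeval x (derivative (polyIter (phi p k) (n + 1))) = 0) :
    x = (critPt p k : D) := by
  obtain ⟨i, hi, h⟩ := exists_critical_of_aeval_derivative_polyIter _ _ hx'
  obtain ⟨j, rfl⟩ := Nat.exists_eq_add_of_le (Nat.lt_succ_iff.1 hi)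
  rw [show i + j + 1 = (j + 1) + i by ring, aeval_polyIter_add] at hx
  rcases aeval_derivative_phi_eq_zero hp (right_ne_zero_of_mul hkp) h with h | h
  · rw [h, aeval_zero_polyIter_phi hp] at hx
    exact absurd (neg_eq_zero.1 hx) hkp
  · rw [h] at hx
    rcases Nat.eq_zero_or_pos i with rfl | hi
    · simpa [polyIter] using h
    · exact absurd hx (aeval_critPt_polyIter_ne_zero hp hkp h0 (by omega))

/-- The multiple root of the reduction has multiplicity at most two. -/
theorem aeval_critPt_derivative_derivative_polyIter_ne_zero [IsDomain D] (hp : 3 ≤ p)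
    (hkp : (k * p : D) ≠ 0)
    (h0 : aeval (critPt p k : D) (polyIter (phi p k) (n + 1)) = 0) :
    aeval (critPt p k : D) (derivative (derivative (polyIter (phi p k) (n + 1)))) ≠ 0 := by
  have hpD := right_ne_zero_of_mul hkp
  have hne {m : ℕ} (hm : m ≤ n) := aeval_critPt_polyIter_ne_zero hp hkp h0 hm
  rw [polyIter_add, polyIter_one, derivative_comp, derivative_mul, map_add, map_mul, map_mul,
    aeval_critPt_derivative_phi hp, zero_mul, add_zero,
    aeval_critPt_derivative_derivative_phi hp, aeval_comp]
  have ha : (critPt p k : D) ≠ 0 := by simpa [polyIter] using hne n.zero_le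
  refine mul_ne_zero (mul_ne_zero hpD (pow_ne_zero _ ha)) fun h => ?_
  obtain ⟨i, hi, hi'⟩ := exists_critical_of_aeval_derivative_polyIter _ _ h
  rw [← aeval_polyIter_succ'] at hi'
  rcases aeval_derivative_phi_eq_zero hp hpD hi' with hc | hc
  · exact hne hi hc
  · obtain ⟨j, rfl⟩ := Nat.exists_eq_add_of_le hi.le
    rw [add_right_comm, add_comm (i + 1), aeval_polyIter_add, hc] at h0
    exact hne (by omega) h0

end Reduction

section DoubleRoot

variable {S : Type*} [CommRing S] {P : Ideal S} {F : S[X]} {a : S}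

theorem eval_sub_eval_mem {x y : S} (h : x - y ∈ P) (G : S[X]) : G.eval x - G.eval y ∈ P :=
  P.mem_of_dvd (sub_dvd_eval_sub x y G) h

theorem exists_prod_eq_of_eval_mem [hP : P.IsPrime] {s : Multiset S}
    (h : ((s.map (X - C ·)).prod).eval a ∈ P) :
    ∃ α t, s = α ::ₘ t ∧ a - α ∈ P := by
  rw [eval_multiset_prod, Multiset.map_map, hP.multiset_prod_mem_iff_exists_mem] at h
  obtain ⟨_, hy, hyP⟩ := h
  obtain ⟨α, hα, rfl⟩ := Multiset.mem_map.1 hy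
  obtain ⟨t, rfl⟩ := Multiset.exists_cons_of_mem hα
  exact ⟨α, t, rfl, by simpa using hyP⟩

/-- A split polynomial with simple roots whose reduction has a unique multiple root, of
multiplicity two, has exactly one pair of roots that become congruent. -/
theorem exists_unique_pair_of_double_root [IsDomain S] [hP : P.IsPrime] (hF : F.Monic)
    (hs : F.Splits)
    (hnd : F.roots.Nodup) (h0 : F.eval a ∈ P) (h1 : F.derivative.eval a = 0)
    (h2 : F.derivative.derivative.eval a ∉ P)
    (huniq : ∀ x, F.eval x ∈ P → F.derivative.eval x ∈ P → x - a ∈ P) :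
    ∃ α β g, α ≠ β ∧ F = (X - C α) * (X - C β) * g ∧ g.eval a ∉ P ∧ a - α ∈ P ∧ a - β ∈ P ∧
      ∀ x y, F.eval x = 0 → F.eval y = 0 → x ≠ y → x - y ∈ P →
        x = α ∧ y = β ∨ x = β ∧ y = α := by
  have hFp := hs.eq_prod_roots_of_monic hF
  obtain ⟨α, s, hαs, hα⟩ := exists_prod_eq_of_eval_mem (hFp ▸ h0)
  rw [hαs, Multiset.map_cons, Multiset.prod_cons] at hFp
  obtain ⟨β, t, rfl, hβ⟩ : ∃ β t, s = β ::ₘ t ∧ a - β ∈ P := by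
    apply exists_prod_eq_of_eval_mem
    set h := (s.map (X - C ·)).prod
    have h1' : h.eval a + (a - α) * h.derivative.eval a = 0 := by
      rw [← h1, hFp]; simp
    rw [eq_neg_of_add_eq_zero_left h1']
    exact P.neg_mem (P.mul_mem_right _ hα)
  rw [Multiset.map_cons, Multiset.prod_cons, ← mul_assoc] at hFp
  set g := (t.map (X - C ·)).prod
  have hg : g.eval a ∉ P := by
    intro hg
    apply h2
    have : F.derivative.derivative.eval a = 2 * g.eval a +
        (a - α) * (2 * g.derivative.eval a) + (a - β) * (2 * g.derivative.eval a) +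
        (a - α) * ((a - β) * g.derivative.derivative.eval a) := by
      rw [hFp]
      simp
      ring
    rw [this]
    exact P.add_mem (P.add_mem (P.add_mem (P.mul_mem_left _ hg) (P.mul_mem_right _ hα))
      (P.mul_mem_right _ hβ)) (P.mul_mem_right _ hα)
  have hαβ : α ≠ β := by
    rw [hαs, Multiset.nodup_cons] at hnd
    rintro rfl
    exact hnd.1 (Multiset.mem_cons_self _ _)
  have hroot (x : S) (hx : F.eval x = 0) (hxa : x - a ∈ P) : x = α ∨ x = β := by
    rw [hFp] at hx
    simp only [eval_mul, eval_sub, eval_X, eval_C, mul_eq_zero, sub_eq_zero] at hx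
    refine hx.resolve_right fun h => hg ?_
    have := eval_sub_eval_mem hxa g
    rw [h, zero_sub] at this
    exact (P.neg_mem_iff).1 this
  refine ⟨α, β, g, hαβ, hFp, hg, hα, hβ, fun x y hx hy hxy hxyP => ?_⟩
  have hmult : F.derivative.eval x ∈ P := by
    obtain ⟨G, hG⟩ := dvd_iff_isRoot.2 hx
    have hGy : G.eval y = 0 := by
      rw [hG] at hy
      simp only [eval_mul, eval_sub, eval_X, eval_C, mul_eq_zero, sub_eq_zero] at hy
      exact hy.resolve_left hxy.symm
    have := eval_sub_eval_mem hxyP G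
    rw [hGy, sub_zero] at this
    rw [hG]
    simpa using this
  have hxa := huniq x (hx ▸ P.zero_mem) hmult
  have hya : y - a ∈ P := by
    have := P.sub_mem hxa hxyP
    rwa [sub_sub_sub_cancel_left] at this
  rcases hroot x hx hxa with rfl | rfl <;> rcases hroot y hy hya with rfl | rfl
  · exact absurd rfl hxy
  · exact Or.inl ⟨rfl, rfl⟩
  · exact Or.inr ⟨rfl, rfl⟩
  · exact absurd rfl hxy

open IsDedekindDomain WithZero in
/-- If two roots of `F` collapse to the critical point `a` modulo `P` and `F(a)` has odd valuation
at the prime `q`, then `q` is ramified at `P`. -/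
theorem mem_sq_of_odd_multiplicity [IsDedekindDomain S] [hP : P.IsPrime] {g : S[X]} {α β : S}
    (hF : F = (X - C α) * (X - C β) * g) (hg : g.eval a ∉ P) (hα : a - α ∈ P) (hβ : a - β ∈ P)
    (h1 : F.derivative.eval a = 0) {q u : S} {m : ℕ} (hq0 : q ≠ 0) (hq : q ∈ P) (hu : u ∉ P)
    (hm : Odd m) (hFa : F.eval a = q ^ m * u) : q ∈ P ^ 2 := by
  by_contra hq2
  let v : HeightOneSpectrum S := ⟨P, hP, fun h => hq0 (by simpa [h] using hq)⟩
  have hv (x : S) : v.intValuation x < 1 ↔ x ∈ P := v.intValuation_lt_one_iff_mem x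
  have hv1 (x : S) (hx : x ∉ P) : v.intValuation x = 1 :=
    (v.intValuation_le_one x).antisymm (not_lt.1 fun h => hx ((hv x).1 h))
  have hvq : v.intValuation q = exp (-1 : ℤ) := by
    obtain ⟨z, hz⟩ : ∃ z : ℤ, v.intValuation q = exp z :=
      ⟨_, (exp_log (v.intValuation_ne_zero q hq0)).symm⟩
    have h1 := (v.intValuation_le_pow_iff_mem q 1).2 (by simpa using hq)
    have h2 := (v.intValuation_le_pow_iff_mem q 2).not.2 hq2
    rw [hz, exp_le_exp] at h1 h2
    rw [hz, exp_inj]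
    push_cast at h1 h2
    omega
  have hval : v.intValuation (a - α) * v.intValuation (a - β) = exp (-1 : ℤ) ^ m := by
    rw [← hvq, ← map_pow, ← mul_one (v.intValuation (q ^ m)), ← hv1 u hu, ← map_mul, ← map_mul,
      ← hFa, hF]
    simp [hv1 _ hg]
  have hder : ((a - α) + (a - β)) * g.eval a = -((a - α) * (a - β)) * g.derivative.eval a := by
    rw [hF] at h1
    simp at h1
    linear_combination h1
  have hle : v.intValuation ((a - α) + (a - β)) ≤
      v.intValuation (a - α) * v.intValuation (a - β) := by
    have := congrArg v.intValuation hder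
    rw [map_mul, hv1 _ hg, mul_one, map_mul, Valuation.map_neg, map_mul] at this
    rw [this]
    exact mul_le_of_le_one_right' (v.intValuation_le_one _)
  have hne0 : v.intValuation (a - α) * v.intValuation (a - β) ≠ 0 := by
    rw [hval]; exact pow_ne_zero _ exp_ne_zero
  obtain ⟨i, hi⟩ : ∃ i : ℤ, v.intValuation (a - α) = exp i :=
    ⟨_, (exp_log (left_ne_zero_of_mul hne0)).symm⟩
  obtain ⟨j, hj⟩ : ∃ j : ℤ, v.intValuation (a - β) = exp j :=
    ⟨_, (exp_log (right_ne_zero_of_mul hne0)).symm⟩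
  have hi0 : i < 0 := by rw [← exp_lt_exp, ← hi, exp_zero, hv]; exact hα
  have hj0 : j < 0 := by rw [← exp_lt_exp, ← hj, exp_zero, hv]; exact hβ
  have hij : i = j := by
    by_contra hne
    rw [Valuation.map_add_of_distinct_val _ (by rwa [hi, hj, ne_eq, exp_inj]), hi, hj, ← exp_add]
      at hle
    have := exp_le_exp.1 ((le_max_left _ _).trans hle)
    omega
  subst hij
  rw [hi, hj, ← exp_add, ← exp_nsmul, exp_inj] at hval
  obtain ⟨l, rfl⟩ := hm
  simp at hval
  omega

end DoubleRoot

section Eisenstein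

variable {p k : ℕ}

theorem map_polyIter_phi (n : ℕ) :
    (polyIter (phi p k) n).map (Int.castRingHom (ZMod p)) = X ^ p ^ n := by
  induction n with
  | zero => simp [polyIter]
  | succ n ih =>
    rw [polyIter, Polynomial.map_comp, ih]
    simp [phi, pow_succ, pow_mul]

theorem irreducible_polyIter_phi (hp : p.Prime) (hp3 : 3 ≤ p) (hpk : ¬ p ∣ k) (n : ℕ) :
    Irreducible ((polyIter (phi p k) n).map (algebraMap ℤ ℚ)) := by
  cases n with
  | zero => simpa [polyIter] using irreducible_X
  | succ n =>
    obtain ⟨hmon, hdeg⟩ := phi_monic_natDegree (k := k) hp.one_lt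
    obtain ⟨hm, hd⟩ := polyIter_monic hmon (by rw [hdeg]; exact hp.ne_zero) (n + 1)
    rw [hdeg] at hd
    have hpZ : Prime (p : ℤ) := Nat.prime_iff_prime_int.1 hp
    have hprime : (Ideal.span {(p : ℤ)}).IsPrime :=
      (Ideal.span_singleton_prime hpZ.ne_zero).2 hpZ
    refine (hm.irreducible_iff_irreducible_map_fraction_map (K := ℚ)).1 ?_
    refine IsEisensteinAt.irreducible (𝓟 := Ideal.span {(p : ℤ)}) ⟨?_, fun {i} hi => ?_, ?_⟩ hprime
      hm.isPrimitive (by rw [hd]; exact pow_pos hp.pos _)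
    · rw [hm.leadingCoeff]
      exact (Ideal.ne_top_iff_one _).1 hprime.ne_top
    · rw [Ideal.mem_span_singleton, ← ZMod.intCast_zmod_eq_zero_iff_dvd]
      have := congrArg (coeff · i) (map_polyIter_phi (p := p) (k := k) (n + 1))
      rw [hd] at hi
      simpa [coeff_X_pow, hi.ne] using this
    · have h0 := aeval_zero_polyIter_phi (D := ℤ) (k := k) hp3 n
      rw [coe_aeval_eq_eval, ← coeff_zero_eq_eval_zero] at h0
      rw [h0, Ideal.span_singleton_pow, Ideal.mem_span_singleton, dvd_neg, sq]
      intro h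
      have := Int.dvd_of_mul_dvd_mul_right (by exact_mod_cast hp.ne_zero) h
      exact hpk (by exact_mod_cast this)

end Eisenstein

section Inertia

open NumberField

variable {p k : ℕ} {L : Type*} [Field L] [NumberField L] [IsGalois ℚ L]

theorem exists_swap_of_prime_odd_multiplicity (hp3 : 3 ≤ p) {n : ℕ}
    (hmon : (polyIter (phi p k) (n + 1)).Monic)
    (hs : ((polyIter (phi p k) (n + 1)).map (algebraMap ℤ L)).Splits)
    (hnd : ((polyIter (phi p k) (n + 1)).map (algebraMap ℤ L)).roots.Nodup)
    (hgen : ∀ σ : L ≃ₐ[ℚ] L,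
      (∀ x, aeval x (polyIter (phi p k) (n + 1)) = 0 → σ x = x) → σ = 1)
    {q m : ℕ} {u : ℤ} (hq : q.Prime) (hqkp : ¬ q ∣ k * p) (hm : Odd m)
    (hval : aeval (critPt p k) (polyIter (phi p k) (n + 1)) = q ^ m * u) (hu : ¬ (q : ℤ) ∣ u) :
    ∃ (σ : L ≃ₐ[ℚ] L) (x y : L), x ≠ y ∧ aeval x (polyIter (phi p k) (n + 1)) = 0 ∧
      aeval y (polyIter (phi p k) (n + 1)) = 0 ∧ σ x = y ∧ σ y = x ∧
      ∀ z, aeval z (polyIter (phi p k) (n + 1)) = 0 → z ≠ x → z ≠ y → σ z = z := by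
  set f := polyIter (phi p k) (n + 1) with hf
  have hinj : Function.Injective (algebraMap (𝓞 L) L) := RingOfIntegers.coe_injective
  set F : (𝓞 L)[X] := f.map (algebraMap ℤ (𝓞 L)) with hFdef
  have hFL : F.map (algebraMap (𝓞 L) L) = f.map (algebraMap ℤ L) := by
    rw [hFdef, Polynomial.map_map, ← IsScalarTower.algebraMap_eq]
  have hFm : F.Monic := hmon.map _
  have hlift (x : L) (hx : aeval x f = 0) : ∃ y : 𝓞 L, algebraMap (𝓞 L) L y = x :=
    ⟨⟨x, f, hmon, by simpa [aeval_def] using hx⟩, rfl⟩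
  have hFs : F.Splits := by
    refine Splits.of_splits_map_of_injective (f := F) hinj (by rwa [hFL]) ?_
    intro x hx
    rw [hFL] at hx
    have := (mem_roots'.1 hx).2
    rw [IsRoot.def, eval_map_algebraMap] at this
    exact hlift x this
  have hFnd : F.roots.Nodup := by
    have := hFs.roots_map_of_injective hinj
    rw [hFL] at this
    rw [this] at hnd
    exact Multiset.Nodup.of_map _ hnd
  have hqZ : Prime (q : ℤ) := Nat.prime_iff_prime_int.1 hq
  have hspan : (Ideal.span {(q : ℤ)}).IsPrime :=
    (Ideal.span_singleton_prime hqZ.ne_zero).2 hqZ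
  obtain ⟨P, hP, hlies⟩ : Nonempty ((Ideal.span {(q : ℤ)}).primesOver (𝓞 L)) := inferInstance
  have hmem (z : ℤ) : (z : 𝓞 L) ∈ P ↔ (q : ℤ) ∣ z := by
    rw [← Ideal.mem_span_singleton, hlies.over, Ideal.mem_comap]
    simp
  have hmemq (x : 𝓞 L) (g : ℤ[X]) : (g.map (algebraMap ℤ (𝓞 L))).eval x ∈ P ↔
      aeval (Ideal.Quotient.mk P x) g = 0 := by
    rw [eval_map_algebraMap, ← Ideal.Quotient.eq_zero_iff_mem, ← Ideal.Quotient.algebraMap_eq,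
      aeval_algebraMap_apply]
  have hkp : (k * p : 𝓞 L ⧸ P) ≠ 0 := by
    have : ((k * p : ℤ) : 𝓞 L) ∉ P := by
      rw [hmem]
      exact_mod_cast hqkp
    rw [← Ideal.Quotient.eq_zero_iff_mem] at this
    simpa using this
  have hFa : F.eval ((critPt p k : ℤ) : 𝓞 L) = (q : 𝓞 L) ^ m * (u : 𝓞 L) := by
    rw [hFdef, eval_map_algebraMap, aeval_intCast_eq, hval]
    push_cast
    rfl
  have hqP : (q : 𝓞 L) ∈ P := by
    have := (hmem q).2 dvd_rfl
    exact_mod_cast this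
  have huP : (u : 𝓞 L) ∉ P := by rwa [hmem]
  have h0 : F.eval ((critPt p k : ℤ) : 𝓞 L) ∈ P := by
    rw [hFa]
    exact P.mul_mem_right _ (P.pow_mem_of_mem hqP _ hm.pos)
  have h0' := (hmemq _ _).1 h0
  rw [map_intCast] at h0'
  have h1 : F.derivative.eval ((critPt p k : ℤ) : 𝓞 L) = 0 := by
    rw [hFdef, derivative_map, eval_map_algebraMap]
    exact aeval_critPt_derivative_polyIter hp3 n
  have h2 : F.derivative.derivative.eval ((critPt p k : ℤ) : 𝓞 L) ∉ P := by
    rw [hFdef, derivative_map, derivative_map, hmemq, map_intCast]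
    exact aeval_critPt_derivative_derivative_polyIter_ne_zero hp3 hkp h0'
  have huniq (x : 𝓞 L) (hx : F.eval x ∈ P) (hx' : F.derivative.eval x ∈ P) :
      x - ((critPt p k : ℤ) : 𝓞 L) ∈ P := by
    rw [hFdef, derivative_map, hmemq] at hx'
    rw [hFdef, hmemq] at hx
    rw [← Ideal.Quotient.eq, map_intCast]
    exact eq_critPt_of_multiple_root hp3 hkp h0' hx hx'
  obtain ⟨α, β, g, hαβ, hFg, hg, hα, hβ, hpair⟩ :=
    exists_unique_pair_of_double_root hFm hFs hFnd h0 h1 h2 huniq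
  have hq0 : (q : 𝓞 L) ≠ 0 := by exact_mod_cast hq.ne_zero
  have hq2 := mem_sq_of_odd_multiplicity hFg hg hα hβ h1 hq0 hqP huP hm hFa
  have hram : Nat.card (P.inertia (L ≃ₐ[ℚ] L)) ≠ 1 := by
    have hmap : (Ideal.span {(q : ℤ)}).map (algebraMap ℤ (𝓞 L)) = Ideal.span {(q : 𝓞 L)} := by
      simp [Ideal.map_span]
    have hbot : (Ideal.span {(q : ℤ)}).map (algebraMap ℤ (𝓞 L)) ≠ ⊥ := by
      rw [hmap]; simpa using hq0
    rw [Ideal.card_inertia_eq_ramificationIdxIn (Ideal.span {(q : ℤ)}) P,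
      Ideal.ramificationIdxIn_eq_ramificationIdx _ P (L ≃ₐ[ℚ] L),
      Ideal.IsDedekindDomain.ramificationIdx_eq_multiplicity (Ideal.span {(q : ℤ)}) P hbot]
    have hfin : FiniteMultiplicity P ((Ideal.span {(q : ℤ)}).map (algebraMap ℤ (𝓞 L))) :=
      FiniteMultiplicity.of_not_isUnit (fun h => hP.ne_top (Ideal.isUnit_iff.1 h)) hbot
    have : 2 ≤ multiplicity P ((Ideal.span {(q : ℤ)}).map (algebraMap ℤ (𝓞 L))) := by
      refine hfin.le_multiplicity_of_pow_dvd ?_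
      rw [hmap, Ideal.dvd_span_singleton]
      exact hq2
    omega
  obtain ⟨⟨σ, hσ⟩, hσ1⟩ : ∃ σ : P.inertia (L ≃ₐ[ℚ] L), σ ≠ 1 := by
    by_contra! h
    exact hram (Nat.card_eq_one_iff_unique.2 ⟨⟨fun a b => (h a).trans (h b).symm⟩, ⟨1⟩⟩)
  rw [AddSubgroup.mem_inertia] at hσ
  have hσ1' : σ ≠ 1 := fun h => hσ1 (Subtype.ext h)
  have hroot (x : 𝓞 L) : F.eval x = 0 ↔ aeval (algebraMap (𝓞 L) L x) f = 0 := by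
    rw [aeval_algebraMap_apply, map_eq_zero_iff _ hinj, hFdef, eval_map_algebraMap]
  have hact (x : 𝓞 L) : algebraMap (𝓞 L) L (σ • x) = σ (algebraMap (𝓞 L) L x) := rfl
  have hsroot (x : 𝓞 L) (hx : F.eval x = 0) : F.eval (σ • x) = 0 := by
    rw [hroot] at hx ⊢
    rw [hact]
    have := aeval_algHom_apply ((σ : L →ₐ[ℚ] L).restrictScalars ℤ) (algebraMap (𝓞 L) L x) f
    rw [hx, map_zero] at this
    exact this
  have hmove (x : 𝓞 L) (hx : F.eval x = 0) (hne : σ • x ≠ x) :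
      σ • x = α ∧ x = β ∨ σ • x = β ∧ x = α :=
    hpair _ _ (hsroot x hx) hx hne (hσ x)
  have hFα : F.eval α = 0 := by rw [hFg]; simp
  have hFβ : F.eval β = 0 := by rw [hFg]; simp
  obtain ⟨x, hx, hne⟩ : ∃ x : 𝓞 L, F.eval x = 0 ∧ σ • x ≠ x := by
    by_contra! h
    refine hσ1' (hgen σ fun x hx => ?_)
    obtain ⟨y, rfl⟩ := hlift x hx
    rw [← hact, h y ((hroot y).2 hx)]
  have key : σ • α = β ∧ σ • β = α := by
    have hcancel := MulAction.injective (β := 𝓞 L) σ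
    rcases hmove x hx hne with ⟨h, rfl⟩ | ⟨h, rfl⟩
    · have hne' : σ • α ≠ α := fun h' => hαβ (hcancel (h'.trans h.symm))
      rcases hmove α hFα hne' with ⟨h', h''⟩ | ⟨h', -⟩
      · exact absurd h'' hαβ
      · exact ⟨h', h⟩
    · have hne' : σ • β ≠ β := fun h' => hαβ (hcancel (h.trans h'.symm))
      rcases hmove β hFβ hne' with ⟨h', -⟩ | ⟨h', h''⟩
      · exact ⟨h, h'⟩
      · exact absurd h'' hαβ.symm
  refine ⟨σ, algebraMap (𝓞 L) L α, algebraMap (𝓞 L) L β, hinj.ne hαβ, (hroot α).1 hFα,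
    (hroot β).1 hFβ, by rw [← hact, key.1], by rw [← hact, key.2], fun z hz hzα hzβ => ?_⟩
  obtain ⟨z, rfl⟩ := hlift z hz
  rw [← hact]
  by_contra hzne
  rcases hmove z ((hroot z).2 hz) (fun h => hzne (by rw [h])) with ⟨-, rfl⟩ | ⟨-, rfl⟩
  · exact hzβ rfl
  · exact hzα rfl

end Inertia

section Counting

variable {p k : ℕ} {L : Type*} [Field L] [CharZero L]

theorem polyIter_phi_monic_natDegree (hp : 1 < p) (n : ℕ) :
    (polyIter (phi p k) n).Monic ∧ (polyIter (phi p k) n).natDegree = p ^ n := by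
  obtain ⟨hmon, hdeg⟩ := phi_monic_natDegree (k := k) hp
  have := polyIter_monic hmon (by omega) n
  rwa [hdeg] at this

theorem mem_rootSet_polyIter_phi (hp : 1 < p) {n : ℕ} {x : L} :
    x ∈ (polyIter (phi p k) n).rootSet L ↔ aeval x (polyIter (phi p k) n) = 0 := by
  rw [mem_rootSet, and_iff_right (polyIter_phi_monic_natDegree hp n).1.ne_zero]

theorem nodup_roots_polyIter_phi (hp : p.Prime) (hp3 : 3 ≤ p) (hpk : ¬ p ∣ k) (n : ℕ) :
    ((polyIter (phi p k) n).map (algebraMap ℤ L)).roots.Nodup := by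
  have := nodup_roots ((irreducible_polyIter_phi hp hp3 hpk n).separable.map
    (f := algebraMap ℚ L))
  rwa [Polynomial.map_map, ← IsScalarTower.algebraMap_eq] at this

theorem card_rootSet_polyIter_phi (hp : p.Prime) (hp3 : 3 ≤ p) (hpk : ¬ p ∣ k) {n : ℕ}
    (hs : ((polyIter (phi p k) n).map (algebraMap ℤ L)).Splits) :
    Nat.card ((polyIter (phi p k) n).rootSet L) = p ^ n := by
  classical
  obtain ⟨hm, hd⟩ := polyIter_phi_monic_natDegree (k := k) hp.one_lt n
  rw [rootSet_def, Nat.card_eq_card_toFinset, Finset.toFinset_coe, aroots_def,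
    Multiset.toFinset_card_of_nodup (nodup_roots_polyIter_phi hp hp3 hpk n),
    ← hs.natDegree_eq_card_roots, hm.natDegree_map, hd]

theorem minpoly_of_aeval_polyIter_phi (hp : p.Prime) (hp3 : 3 ≤ p) (hpk : ¬ p ∣ k) {n : ℕ}
    {x : L} (hx : aeval x (polyIter (phi p k) n) = 0) :
    minpoly ℚ x = (polyIter (phi p k) n).map (algebraMap ℤ ℚ) :=
  (minpoly.eq_of_irreducible_of_monic (irreducible_polyIter_phi hp hp3 hpk n)
    (by rwa [aeval_map_algebraMap])
    ((polyIter_phi_monic_natDegree hp.one_lt n).1.map _)).symm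

/-- Applying `φ` maps the roots of an iterate to the roots of the previous iterate. -/
noncomputable def rootMap (p k : ℕ) (hp : 1 < p) (L : Type*) [Field L] [CharZero L] (n : ℕ)
    (x : (polyIter (phi p k) (n + 1)).rootSet L) : (polyIter (phi p k) n).rootSet L :=
  ⟨aeval (x : L) (phi p k), by
    have := (mem_rootSet_polyIter_phi hp).1 x.2
    rwa [aeval_polyIter_succ', ← mem_rootSet_polyIter_phi hp] at this⟩

theorem card_rootMap_fiber (hp : p.Prime) (hp3 : 3 ≤ p) (hpk : ¬ p ∣ k) {n : ℕ}
    (hs : ((polyIter (phi p k) n).map (algebraMap ℤ L)).Splits)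
    (hs' : ((polyIter (phi p k) (n + 1)).map (algebraMap ℤ L)).Splits)
    (b : (polyIter (phi p k) n).rootSet L) :
    Nat.card {y // rootMap p k hp.one_lt L n y = b} = p := by
  have hle (b : (polyIter (phi p k) n).rootSet L) :
      Nat.card {y // rootMap p k hp.one_lt L n y = b} ≤ p := by
    classical
    obtain ⟨hm, hd⟩ := phi_monic_natDegree (k := k) hp.one_lt
    set h : L[X] := (phi p k).map (algebraMap ℤ L) - C (b : L) with hh
    have hdeg : h.natDegree = p := by rw [hh, natDegree_sub_C, hm.natDegree_map, hd]
    have h0 : h ≠ 0 := by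
      rintro h0
      rw [h0, natDegree_zero] at hdeg
      exact hp.ne_zero hdeg.symm
    have hinj : Function.Injective (fun y : {y // rootMap p k hp.one_lt L n y = b} =>
        (⟨((y : (polyIter (phi p k) (n + 1)).rootSet L) : L), by
          have := congrArg Subtype.val y.2
          rw [Multiset.mem_toFinset, mem_roots h0, IsRoot.def, hh, eval_sub, eval_C,
            eval_map_algebraMap, sub_eq_zero]
          exact this⟩ : h.roots.toFinset)) := fun y z hyz => by
      simpa [Subtype.ext_iff] using hyz
    refine (Nat.card_le_card_of_injective _ hinj).trans ?_
    rw [Nat.card_eq_fintype_card, Fintype.card_coe]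
    exact (Multiset.toFinset_card_le _).trans (h.card_roots'.trans hdeg.le)
  have hsum : ∑ b, Nat.card {y // rootMap p k hp.one_lt L n y = b} =
      ∑ _b : (polyIter (phi p k) n).rootSet L, p := by
    rw [← Nat.card_sigma, Nat.card_congr (Equiv.sigmaFiberEquiv _),
      card_rootSet_polyIter_phi hp hp3 hpk hs', Finset.sum_const, Finset.card_univ,
      ← Nat.card_eq_fintype_card, card_rootSet_polyIter_phi hp hp3 hpk hs, pow_succ, smul_eq_mul]
  exact (Finset.sum_eq_sum_iff_of_le fun b _ => hle b).1 hsum b (Finset.mem_univ b)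

end Counting

section GaloisCounting

variable {p k : ℕ} {L : Type*} [Field L] [NumberField L] [IsGalois ℚ L]

theorem card_algEquiv_fixing_roots (hp : p.Prime) (hp3 : 3 ≤ p) (hpk : ¬ p ∣ k) {n : ℕ}
    (hs : ((polyIter (phi p k) (n + 1)).map (algebraMap ℤ L)).Splits)
    (hgen : ∀ σ : L ≃ₐ[ℚ] L,
      (∀ x, aeval x (polyIter (phi p k) (n + 1)) = 0 → σ x = x) → σ = 1)
    {q m : ℕ} {u : ℤ} (hq : q.Prime) (hqkp : ¬ q ∣ k * p) (hm : Odd m)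
    (hval : aeval (critPt p k) (polyIter (phi p k) (n + 1)) = q ^ m * u) (hu : ¬ (q : ℤ) ∣ u) :
    Nat.card {σ : L ≃ₐ[ℚ] L // ∀ x, aeval x (polyIter (phi p k) n) = 0 → σ x = x} =
      p.factorial ^ p ^ n := by
  classical
  have hmem {j : ℕ} {x : L} :=
    mem_rootSet_polyIter_phi (L := L) (k := k) hp.one_lt (n := j) (x := x)
  set Ω := (polyIter (phi p k) (n + 1)).rootSet L
  let ρ := MulAction.toPermHom (L ≃ₐ[ℚ] L) Ω
  set π := rootMap p k hp.one_lt L n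
  have hρ (σ : L ≃ₐ[ℚ] L) (x : Ω) : (ρ σ x : L) = σ x := rfl
  have hcomm (σ : L ≃ₐ[ℚ] L) (x : L) : aeval (σ x) (phi p k) = σ (aeval x (phi p k)) :=
    aeval_algHom_apply ((σ : L →ₐ[ℚ] L).restrictScalars ℤ) x (phi p k)
  have hπ (σ : L ≃ₐ[ℚ] L) (x : Ω) : (π (ρ σ x) : L) = σ (π x) := hcomm σ x
  obtain ⟨x₀⟩ : Nonempty Ω := by
    have := card_rootSet_polyIter_phi hp hp3 hpk hs
    exact (Nat.card_pos_iff.1 (this ▸ pow_pos hp.pos _)).1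
  have hs₀ : ((polyIter (phi p k) n).map (algebraMap ℤ L)).Splits := by
    have := IsGalois.to_normal.splits (F := ℚ) (π x₀ : L)
    rw [minpoly_of_aeval_polyIter_phi hp hp3 hpk (hmem.1 (π x₀).2), Polynomial.map_map,
      ← IsScalarTower.algebraMap_eq] at this
    exact this
  have hfib (b) : Nat.card {y // π y = b} = p := card_rootMap_fiber hp hp3 hpk hs₀ hs b
  have htrans (x y : Ω) : ∃ g ∈ ρ.range, g x = y := by
    have h : minpoly ℚ (y : L) = minpoly ℚ (x : L) := by
      rw [minpoly_of_aeval_polyIter_phi hp hp3 hpk (hmem.1 x.2),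
        minpoly_of_aeval_polyIter_phi hp hp3 hpk (hmem.1 y.2)]
    obtain ⟨σ, hσ⟩ := (Normal.minpoly_eq_iff_mem_orbit L).1 h
    exact ⟨ρ σ, ⟨σ, rfl⟩, Subtype.ext hσ⟩
  have hblock : ∀ g ∈ ρ.range, ∀ x y, π x = π y → π (g x) = π (g y) := by
    rintro _ ⟨σ, rfl⟩ x y h
    exact Subtype.ext (by rw [hπ, hπ, h])
  obtain ⟨τ, x, y, hxy, hx, hy, hτx, hτy, hτ⟩ := exists_swap_of_prime_odd_multiplicity hp3
    (polyIter_phi_monic_natDegree hp.one_lt _).1 hs (nodup_roots_polyIter_phi hp hp3 hpk _) hgen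
    hq hqkp hm hval hu
  have hswap : Equiv.swap (⟨x, hmem.2 hx⟩ : Ω) ⟨y, hmem.2 hy⟩ ∈ ρ.range := by
    refine ⟨τ, Equiv.ext fun z => Subtype.ext ?_⟩
    rw [hρ, Equiv.swap_apply_def]
    split_ifs with h₁ h₂
    · simp [h₁, hτx]
    · simp [h₂, hτy]
    · exact hτ z (hmem.1 z.2) (fun h => h₁ (Subtype.ext h)) (fun h => h₂ (Subtype.ext h))
  have hall := mem_of_swap_mem_of_prime_fiber ρ.range htrans π hblock hp (fun x => hfib (π x))
    (fun h => hxy (congrArg Subtype.val h)) hswap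
  rw [← card_fiber_preserving π (card_rootSet_polyIter_phi hp hp3 hpk hs₀) hfib]
  refine Nat.card_congr (Equiv.ofBijective (fun σ => ⟨ρ σ.1, fun x => Subtype.ext ?_⟩) ⟨?_, ?_⟩)
  · rw [hπ, σ.2 _ (hmem.1 (π x).2)]
  · intro σ τ h
    have h' : ρ σ.1 = ρ τ.1 := congrArg Subtype.val h
    refine Subtype.ext (inv_mul_eq_one.1 (hgen _ fun x hx => ?_)).symm
    have := congrArg Subtype.val (Equiv.congr_fun h' ⟨x, hmem.2 hx⟩)
    rw [hρ, hρ] at this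
    exact τ.1.symm_apply_eq.2 this
  · rintro ⟨g, hg⟩
    obtain ⟨σ, rfl⟩ := hall g hg
    refine ⟨⟨σ, fun z hz => ?_⟩, rfl⟩
    obtain ⟨⟨w, hw⟩⟩ : Nonempty {w // π w = ⟨z, hmem.2 hz⟩} :=
      (Nat.card_pos_iff.1 ((hfib _).symm ▸ hp.pos)).1
    have h := hπ σ w
    rw [hg w, hw] at h
    exact h.symm

end GaloisCounting

section SplittingField

variable {φ : ℤ[X]}

theorem rootSet_map_int {A : Type*} [Field A] [CharZero A] (f : ℤ[X]) :
    (f.map (algebraMap ℤ ℚ)).rootSet A = f.rootSet A := by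
  simp only [rootSet, aroots, Polynomial.map_map]
  rw [← IsScalarTower.algebraMap_eq]

theorem isSplittingField_Kfield (n : ℕ) :
    IsSplittingField ℚ (Kfield φ n) ((polyIter φ n).map (algebraMap ℤ ℚ)) := by
  have := IntermediateField.adjoin_rootSet_isSplittingField (K := ℚ)
    (IsAlgClosed.splits
      (((polyIter φ n).map (algebraMap ℤ ℚ)).map (algebraMap ℚ (AlgebraicClosure ℚ))))
  rwa [rootSet_map_int] at this

theorem Kfield_le_succ (hφ : φ.Monic) (hd : φ.natDegree ≠ 0) (n : ℕ) :
    Kfield φ n ≤ Kfield φ (n + 1) := by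
  refine IntermediateField.adjoin_le_iff.2 fun y hy => ?_
  have hmon := (polyIter_monic hφ hd (n + 1)).1
  have hdeg : ((φ.map (algebraMap ℤ (AlgebraicClosure ℚ))) - C y).degree ≠ 0 := by
    refine fun h => hd ?_
    have := natDegree_eq_of_degree_eq_some (n := 0) (by simpa using h)
    rwa [natDegree_sub_C, hφ.natDegree_map] at this
  obtain ⟨x, hx⟩ := IsAlgClosed.exists_root _ hdeg
  rw [IsRoot.def, eval_sub, eval_C, eval_map_algebraMap, sub_eq_zero] at hx
  have hxmem : x ∈ Kfield φ (n + 1) := by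
    refine IntermediateField.subset_adjoin _ _ ?_
    exact mem_rootSet.2 ⟨hmon.ne_zero, (aeval_polyIter_succ' φ n x).trans
      ((congrArg (fun z => aeval z (polyIter φ n)) hx).trans (mem_rootSet.1 hy).2)⟩
  have := aeval_algebraMap_apply (AlgebraicClosure ℚ) (⟨x, hxmem⟩ : Kfield φ (n + 1)) φ
  rw [← hx]
  refine this ▸ SetLike.coe_mem _

theorem fixes_Kfield_iff {m n : ℕ} (hm : polyIter φ m ≠ 0) (hle : Kfield φ m ≤ Kfield φ n)
    (σ : Kfield φ n ≃ₐ[ℚ] Kfield φ n) :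
    (∀ (x : AlgebraicClosure ℚ) (_ : x ∈ Kfield φ m) (hx : x ∈ Kfield φ n),
      σ ⟨x, hx⟩ = ⟨x, hx⟩) ↔ ∀ x, aeval x (polyIter φ m) = 0 → σ x = x := by
  have hroot (x : Kfield φ n) : aeval x (polyIter φ m) = 0 ↔
      (x : AlgebraicClosure ℚ) ∈ (polyIter φ m).rootSet (AlgebraicClosure ℚ) := by
    have := aeval_algebraMap_apply (AlgebraicClosure ℚ) x (polyIter φ m)
    rw [mem_rootSet, and_iff_right hm]
    change _ ↔ aeval (algebraMap _ (AlgebraicClosure ℚ) x) _ = 0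
    rw [this]
    exact (map_eq_zero (algebraMap (Kfield φ n) (AlgebraicClosure ℚ))).symm
  constructor
  · intro h x hx
    exact h x (IntermediateField.subset_adjoin _ _ ((hroot x).1 hx)) x.2
  · intro h x hx hx'
    have : (σ : Kfield φ n →ₐ[ℚ] Kfield φ n).comp (IntermediateField.inclusion hle) =
        IntermediateField.inclusion hle :=
      IntermediateField.algHom_ext_of_eq_adjoin ℚ rfl fun y hy => h _ ((hroot _).2 hy)
    exact DFunLike.congr_fun this ⟨x, hx⟩

end SplittingField

section Main

variable {p k : ℕ}

theorem relGalCard_phi_succ (hp : p.Prime) (hp3 : 3 ≤ p) (hpk : ¬ p ∣ k) {n : ℕ}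
    {q m : ℕ} {u : ℤ} (hq : q.Prime) (hqkp : ¬ q ∣ k * p) (hm : Odd m)
    (hval : aeval (critPt p k) (polyIter (phi p k) (n + 1)) = q ^ m * u) (hu : ¬ (q : ℤ) ∣ u) :
    relGalCard (phi p k) (n + 1) = p.factorial ^ p ^ n := by
  have hsplit := isSplittingField_Kfield (φ := phi p k) (n + 1)
  have : NumberField (Kfield (phi p k) (n + 1)) :=
    { to_charZero := inferInstance
      to_finiteDimensional := IsSplittingField.finiteDimensional _
        ((polyIter (phi p k) (n + 1)).map (algebraMap ℤ ℚ)) }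
  have : IsGalois ℚ (Kfield (phi p k) (n + 1)) :=
    IsGalois.of_separable_splitting_field (irreducible_polyIter_phi hp hp3 hpk (n + 1)).separable
  have hne (j : ℕ) : polyIter (phi p k) j ≠ 0 :=
    (polyIter_phi_monic_natDegree hp.one_lt j).1.ne_zero
  obtain ⟨hmon, hdeg⟩ := phi_monic_natDegree (k := k) hp.one_lt
  have hs : ((polyIter (phi p k) (n + 1)).map
      (algebraMap ℤ (Kfield (phi p k) (n + 1)))).Splits := by
    have := hsplit.splits
    rwa [Polynomial.map_map, ← IsScalarTower.algebraMap_eq] at this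
  have hgen (σ : Kfield (phi p k) (n + 1) ≃ₐ[ℚ] Kfield (phi p k) (n + 1))
      (hσ : ∀ x, aeval x (polyIter (phi p k) (n + 1)) = 0 → σ x = x) : σ = 1 :=
    AlgEquiv.ext fun x => (fixes_Kfield_iff (hne _) le_rfl σ).2 hσ x x.2 x.2
  rw [← card_algEquiv_fixing_roots hp hp3 hpk hs hgen hq hqkp hm hval hu]
  exact Nat.card_congr (Equiv.subtypeEquivRight (fixes_Kfield_iff (hne n)
    (Kfield_le_succ hmon (by rw [hdeg]; exact hp.ne_zero) n)))

end Main

/-- For `p ≥ 3` prime, `k ≥ 1` with `p ∤ k`,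
`φ(x) = x^p + kp·x^{p-1} - kp` and `a = -k(p-1)`: if the forward orbit of `a` under `φ`
is infinite (the values `φ^n(a)`, `n ≥ 1`, are pairwise distinct), then for all sufficiently
large `n` the extension `K_n/K_{n-1}` is maximal, i.e. `Gal(K_n/K_{n-1})` has order
`(p!)^(p^(n-1))`. -/
theorem stmt_1 (p k : ℕ) (hp : p.Prime) (hp3 : 3 ≤ p) (hk : 0 < k) (hpk : ¬ p ∣ k)
    (φ : Polynomial ℤ)
    (hφ : φ = X ^ p + C ((k : ℤ) * p) * X ^ (p - 1) - C ((k : ℤ) * p))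
    (a : ℤ) (ha : a = -(k : ℤ) * ((p : ℤ) - 1))
    (horbit : ∀ m n : ℕ, 1 ≤ m → 1 ≤ n →
      (polyIter φ m).eval a = (polyIter φ n).eval a → m = n) :
    ∃ N : ℕ, ∀ n : ℕ, N ≤ n → relGalCard φ n = (Nat.factorial p) ^ (p ^ (n - 1)) := by
  obtain rfl : φ = phi p k := hφ
  obtain rfl : a = critPt p k := ha
  simp only [← coe_aeval_eq_eval] at horbit
  obtain ⟨N, hN⟩ := exists_good_prime hp hp3 hk hpk horbit
  refine ⟨N + 1, fun n hn => ?_⟩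
  obtain ⟨n, rfl⟩ : ∃ j, n = j + 1 := ⟨n - 1, by omega⟩
  obtain ⟨q, m, u, hq, hqkp, hm, hval, hu⟩ := hN n (by omega)
  exact relGalCard_phi_succ hp hp3 hpk hq hqkp hm hval hu
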